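/- Let G be a finite group such that for every maximal subgroup M of G the quotient G/M_G (M_G the normal core of M in G) is nearly nilpotent. Then G is nearly nilpotent. -/

import Mathlib

open Subgroup Pointwise

variable {G : Type*} [Group G]

/-- A subgroup `M` of `G` is modular if it is a modular element of the lattice of
subgroups of `G`. -/
def IsModularSubgroup (M : Subgroup G) : Prop :=
  (∀ X Z : Subgroup G, X ≤ Z → X ⊔ (M ⊓ Z) = (X ⊔ M) ⊓ Z) ∧
  (∀ Y Z : Subgroup G, M ≤ Z → M ⊔ (Y ⊓ Z) = (M ⊔ Y) ⊓ Z)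

/-- A subgroup `H` of `G` is S-quasinormal if `HP = PH` for every Sylow subgroup `P` of `G`. -/
def IsSQuasinormal (H : Subgroup G) : Prop :=
  ∀ (p : ℕ), p.Prime → ∀ P : Sylow p G,
    (H : Set G) * ((P : Subgroup G) : Set G) = ((P : Subgroup G) : Set G) * (H : Set G)

/-- `H` is a maximal subgroup of `K` (both being subgroups of the ambient group `G`). -/
def IsMaximalIn (K H : Subgroup G) : Prop :=
  H < K ∧ ∀ L : Subgroup G, H < L → L ≤ K → L = K

/-- `H` is an `n`-maximal subgroup of `G`: there is a chain
`H = M_n < … < M_1 < M_0 = G` with `M_i` maximal in `M_{i-1}` for all `i`. -/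
def IsNMaximal (n : ℕ) (H : Subgroup G) : Prop :=
  ∃ M : Fin (n + 1) → Subgroup G,
    M 0 = ⊤ ∧ M (Fin.last n) = H ∧
    ∀ i : Fin n, IsMaximalIn (M i.castSucc) (M i.succ)

/-- A group is supersoluble if it has a normal series with cyclic factors. -/
def IsSupersoluble (G : Type*) [Group G] : Prop :=
  ∃ (n : ℕ) (s : Fin (n + 1) → Subgroup G) (_hnorm : ∀ i, (s i).Normal),
    s 0 = ⊥ ∧ s (Fin.last n) = ⊤ ∧
    ∀ i : Fin n, s i.castSucc ≤ s i.succ ∧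
      haveI := _hnorm i.castSucc
      IsCyclic ↥((s i.succ).map (QuotientGroup.mk' (s i.castSucc)))

/-- `H/K` is a chief factor of `G`: both are normal in `G`, `K < H`, and there is no
normal subgroup of `G` strictly between `K` and `H` (i.e. `H/K` is a minimal normal
subgroup of `G/K`). -/
def IsChiefFactor (H K : Subgroup G) : Prop :=
  K.Normal ∧ H.Normal ∧ K < H ∧
    ∀ N : Subgroup G, N.Normal → K < N → N ≤ H → N = H

/-- The centralizer `C_G(H/K)` of a factor `H/K`: the preimage in `G` of the
centralizer of `HK/K` in `G/K`. -/
def chiefCentralizer (H K : Subgroup G) (hK : K.Normal) : Subgroup G :=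
  haveI := hK
  Subgroup.comap (QuotientGroup.mk' K)
    (Subgroup.centralizer ((H.map (QuotientGroup.mk' K) : Subgroup (G ⧸ K)) : Set (G ⧸ K)))

/-- The factor `H/K` is non-Frattini, i.e. `HK/K ≰ Φ(G/K)`. -/
def IsNonFrattini (H K : Subgroup G) (hK : K.Normal) : Prop :=
  haveI := hK
  ¬ H.map (QuotientGroup.mk' K) ≤ frattini (G ⧸ K)

/-- A group is strongly supersoluble if it is supersoluble and the automorphism group
`G/C_G(H/K)` induced by `G` on any chief factor `H/K` has square-free order. -/
def IsStronglySupersoluble (G : Type*) [Group G] : Prop :=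
  IsSupersoluble G ∧
    ∀ H K : Subgroup G, ∀ hc : IsChiefFactor H K,
      Squarefree (chiefCentralizer H K hc.1).index

/-- A group is nearly nilpotent if it is supersoluble and the automorphism group
`G/C_G(H/K)` induced by `G` on any non-Frattini chief factor `H/K` has order dividing
a prime. -/
def IsNearlyNilpotent (G : Type*) [Group G] : Prop :=
  IsSupersoluble G ∧
    ∀ H K : Subgroup G, ∀ hc : IsChiefFactor H K, IsNonFrattini H K hc.1 →
      ∃ p : ℕ, p.Prime ∧ (chiefCentralizer H K hc.1).index ∣ p

/-- The strongly supersoluble residual `G^{U_s}`: the intersection of all normal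
subgroups `N` of `G` with `G/N` strongly supersoluble. -/
def ssResidual (G : Type*) [Group G] : Subgroup G :=
  sInf {N : Subgroup G | ∃ _hN : N.Normal,
    haveI := _hN
    IsStronglySupersoluble (G ⧸ N)}

/-- A minimal normal subgroup. -/
def IsMinimalNormal {G : Type*} [Group G] (N : Subgroup G) : Prop :=
  N.Normal ∧ N ≠ ⊥ ∧ ∀ K : Subgroup G, K.Normal → K ≠ ⊥ → K ≤ N → K = N

theorem exists_isMinimalNormal_le {G : Type*} [Group G] [Finite G] {H : Subgroup G}
    (hH : H.Normal) (hbot : H ≠ ⊥) : ∃ N ≤ H, IsMinimalNormal N := by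
  obtain ⟨N, hN⟩ := (Set.toFinite {K : Subgroup G | K.Normal ∧ K ≠ ⊥ ∧ K ≤ H}).exists_minimal
    ⟨H, hH, hbot, le_rfl⟩
  refine ⟨N, hN.prop.2.2, hN.prop.1, hN.prop.2.1, fun K hK hKb hKN => ?_⟩
  exact le_antisymm hKN (hN.le_of_le ⟨hK, hKb, hKN.trans hN.prop.2.2⟩ hKN)

theorem IsMinimalNormal.le_of_inf_ne_bot {G : Type*} [Group G] {N R : Subgroup G}
    (hN : IsMinimalNormal N) (hR : R.Normal) (h : N ⊓ R ≠ ⊥) : N ≤ R := by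
  have := hN.1
  exact inf_eq_left.1 (hN.2.2 (N ⊓ R) inferInstance h inf_le_left)

theorem normal_of_le_of_isCyclic {G : Type*} [Group G] {N K : Subgroup G} (hN : N.Normal)
    [IsCyclic N] (hK : K ≤ N) : K.Normal := by
  refine ⟨fun k hk g => ?_⟩
  obtain ⟨m, hm⟩ := MonoidHom.map_cyclic (MulAut.conjNormal (H := N) g).toMonoidHom
  have h := congrArg Subtype.val (hm ⟨k, hK hk⟩)
  have h' : g * k * g⁻¹ = k ^ m := by simpa using h
  exact h' ▸ zpow_mem hk m

theorem IsMinimalNormal.prime_card {G : Type*} [Group G] {N : Subgroup G}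
    (hN : IsMinimalNormal N) [IsCyclic N] : (Nat.card N).Prime := by
  let : CommGroup N := IsCyclic.commGroup
  have : Nontrivial N := (Subgroup.nontrivial_iff_ne_bot N).2 hN.2.1
  have : IsSimpleGroup N := by
    refine ⟨fun K _ => ?_⟩
    by_cases hK : K.map N.subtype = ⊥
    · left
      exact (Subgroup.map_eq_bot_iff_of_injective K N.subtype_injective).1 hK
    · right
      have hle : K.map N.subtype ≤ N := by
        rintro _ ⟨x, _, rfl⟩
        exact x.2
      have h := hN.2.2 _ (normal_of_le_of_isCyclic hN.1 hle) hK hle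
      rw [eq_top_iff]
      intro x _
      have hx : (x : G) ∈ K.map N.subtype := h.ge x.2
      obtain ⟨y, hy, hxy⟩ := hx
      rwa [← Subtype.ext hxy]
  exact IsSimpleGroup.prime_card

theorem IsSupersoluble.isCyclic_of_isMinimalNormal {G G' : Type*} [Group G] [Group G']
    (hG' : IsSupersoluble G') (f : G →* G') {N : Subgroup G} (hN : IsMinimalNormal N)
    (hf : N ⊓ f.ker = ⊥) : IsCyclic N := by
  obtain ⟨n, s, hs, h0, hn, hstep⟩ := hG'
  by_contra hcyc
  have key : ∀ i : Fin (n + 1), ¬ N ≤ (s i).comap f := by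
    intro i
    induction i using Fin.induction with
    | zero =>
      rw [h0, MonoidHom.comap_bot]
      intro h
      exact hN.2.1 ((inf_eq_left.2 h).symm.trans hf)
    | succ i ih =>
      intro hle
      apply hcyc
      have := hs i.castSucc
      have := (hstep i).2
      have hinf : N ⊓ (s i.castSucc).comap f = ⊥ := by
        by_contra hne
        exact ih (hN.le_of_inf_ne_bot inferInstance hne)
      let φ : N →* ((s i.succ).map (QuotientGroup.mk' (s i.castSucc)) : Subgroup _) :=
        (((QuotientGroup.mk' (s i.castSucc)).comp f).comp N.subtype).codRestrict _
          fun x => ⟨f x, hle x.2, rfl⟩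
      refine isCyclic_of_injective φ ((injective_iff_map_eq_one φ).2 fun x hx => ?_)
      have hx' : (QuotientGroup.mk' (s i.castSucc)) (f x) = 1 := congrArg Subtype.val hx
      have hmem : (x : G) ∈ N ⊓ (s i.castSucc).comap f :=
        ⟨x.2, (QuotientGroup.eq_one_iff (f x)).1 hx'⟩
      rw [hinf, Subgroup.mem_bot] at hmem
      exact Subtype.ext hmem
  exact key (Fin.last n) (by simp [hn])

theorem IsSupersoluble.of_surjective {G G' : Type*} [Group G] [Group G'] (hG : IsSupersoluble G)
    (f : G →* G') (hf : Function.Surjective f) : IsSupersoluble G' := by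
  obtain ⟨n, s, hs, h0, hn, hstep⟩ := hG
  refine ⟨n, fun i => (s i).map f, fun i => (hs i).map f hf, by simp [h0],
    by simp [hn, Subgroup.map_top_of_surjective f hf], fun i => ⟨Subgroup.map_mono (hstep i).1, ?_⟩⟩
  have := hs i.castSucc
  have := (hs i.castSucc).map f hf
  have := (hstep i).2
  let ψ := QuotientGroup.map (s i.castSucc) ((s i.castSucc).map f) f (Subgroup.le_comap_map _ _)
  have hψ : ((s i.succ).map f).map (QuotientGroup.mk' ((s i.castSucc).map f)) =
      ((s i.succ).map (QuotientGroup.mk' (s i.castSucc))).map ψ := by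
    rw [Subgroup.map_map, Subgroup.map_map]
    rfl
  change IsCyclic (((s i.succ).map f).map (QuotientGroup.mk' ((s i.castSucc).map f)) : Subgroup _)
  rw [hψ]
  exact isCyclic_of_surjective (ψ.subgroupMap _) (ψ.subgroupMap_surjective _)

theorem IsSupersoluble.of_isCyclic_ker {G G' : Type*} [Group G] [Group G']
    (hG' : IsSupersoluble G') (f : G →* G') (hcyc : IsCyclic f.ker) : IsSupersoluble G := by
  obtain ⟨n, s, hs, h0, hn, hstep⟩ := hG'
  have hnorm : ∀ i : Fin (n + 2),
      (Fin.cons ⊥ (fun j => (s j).comap f) : Fin (n + 2) → Subgroup G) i |>.Normal := by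
    intro i
    cases i using Fin.cases with
    | zero => exact Subgroup.normal_bot
    | succ i => exact (hs i).comap f
  refine ⟨n + 1, Fin.cons ⊥ fun j => (s j).comap f, hnorm, rfl, ?_, fun i => ?_⟩
  · rw [← Fin.succ_last, Fin.cons_succ, hn, Subgroup.comap_top]
  · cases i using Fin.cases with
    | zero =>
      refine ⟨bot_le, ?_⟩
      have h1 : (Fin.cons ⊥ (fun j => (s j).comap f) : Fin (n + 2) → Subgroup G)
          (Fin.succ 0) = f.ker := by
        rw [Fin.cons_succ, h0, MonoidHom.comap_bot]
      rw [h1]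
      exact isCyclic_of_surjective (MonoidHom.subgroupMap _ f.ker)
        (MonoidHom.subgroupMap_surjective _ _)
    | succ i =>
      refine ⟨Subgroup.comap_mono (hstep i).1, ?_⟩
      have := hs i.castSucc
      have := (hs i.castSucc).comap f
      have := (hstep i).2
      let ψ := QuotientGroup.map ((s i.castSucc).comap f) (s i.castSucc) f le_rfl
      have hψ : Function.Injective ψ := by
        refine (injective_iff_map_eq_one ψ).2 fun x hx => ?_
        obtain ⟨x, rfl⟩ := QuotientGroup.mk_surjective x
        exact (QuotientGroup.eq_one_iff _).2 ((QuotientGroup.eq_one_iff (N := s i.castSucc) _).1 hx)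
      change IsCyclic (((s i.succ).comap f).map
        (QuotientGroup.mk' ((s i.castSucc).comap f)) : Subgroup _)
      refine isCyclic_of_injective
        (G' := ((s i.succ).map (QuotientGroup.mk' (s i.castSucc)) : Subgroup _))
        ((ψ.comp (Subgroup.subtype _)).codRestrict _ ?_) ?_
      · rintro ⟨_, x, hx, rfl⟩
        exact ⟨f x, hx, rfl⟩
      · intro x y hxy
        exact Subtype.ext (hψ (congrArg Subtype.val hxy))

open scoped commutatorElement

/-- The normal subgroup generated by all commutators and all `(p - 1)`-th powers. -/
def powCommutator (p : ℕ) (G : Type*) [Group G] : Subgroup G :=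
  Subgroup.normalClosure {x | (∃ a b : G, x = ⁅a, b⁆) ∨ ∃ a : G, x = a ^ (p - 1)}

instance powCommutator_normal (p : ℕ) (G : Type*) [Group G] : (powCommutator p G).Normal :=
  Subgroup.normalClosure_normal

theorem commutator_mem_powCommutator (p : ℕ) {G : Type*} [Group G] (a b : G) :
    ⁅a, b⁆ ∈ powCommutator p G :=
  Subgroup.subset_normalClosure (Or.inl ⟨a, b, rfl⟩)

theorem pow_mem_powCommutator (p : ℕ) {G : Type*} [Group G] (a : G) :
    a ^ (p - 1) ∈ powCommutator p G :=
  Subgroup.subset_normalClosure (Or.inr ⟨a, rfl⟩)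

theorem powCommutator_le_comap (p : ℕ) {G G' : Type*} [Group G] [Group G'] (f : G →* G') :
    powCommutator p G ≤ (powCommutator p G').comap f := by
  refine Subgroup.normalClosure_le_normal ?_
  rintro _ (⟨a, b, rfl⟩ | ⟨a, rfl⟩)
  · change f ⁅a, b⁆ ∈ powCommutator p G'
    rw [map_commutatorElement]
    exact commutator_mem_powCommutator p _ _
  · change f (a ^ (p - 1)) ∈ powCommutator p G'
    rw [map_pow]
    exact pow_mem_powCommutator p _

theorem powCommutator_le_centralizer {p : ℕ} [hp : Fact p.Prime] {G : Type*} [Group G]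
    {A : Subgroup G} (hA : A.Normal) (hcard : Nat.card A = p) :
    powCommutator p G ≤ Subgroup.centralizer A := by
  have : IsCyclic A := isCyclic_of_prime_card hcard
  subst hcard
  let χ : G →* (ZMod (Nat.card A))ˣ :=
    (IsCyclic.mulAutMulEquiv A).toMonoidHom.comp (MulAut.conjNormal (H := A))
  have hker : χ.ker ≤ Subgroup.centralizer A := by
    intro g hg
    have h1 : MulAut.conjNormal (H := A) g = 1 :=
      (IsCyclic.mulAutMulEquiv A).injective (hg.trans (map_one _).symm)
    rw [Subgroup.mem_centralizer_iff]
    intro a ha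
    have h2 : ((MulAut.conjNormal g ⟨a, ha⟩ : A) : G) = a := by rw [h1]; rfl
    rw [MulAut.conjNormal_apply] at h2
    exact (mul_inv_eq_iff_eq_mul.1 h2).symm
  refine le_trans (Subgroup.normalClosure_le_normal ?_) hker
  rintro _ (⟨a, b, rfl⟩ | ⟨a, rfl⟩)
  · change χ ⁅a, b⁆ = 1
    rw [map_commutatorElement, commutatorElement_eq_one_iff_mul_comm, mul_comm]
  · change χ (a ^ (Nat.card A - 1)) = 1
    rw [map_pow, ZMod.units_pow_card_sub_one_eq_one]

theorem IsSupersoluble.quotient {G : Type*} [Group G] (hG : IsSupersoluble G) (N : Subgroup G)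
    [N.Normal] : IsSupersoluble (G ⧸ N) :=
  hG.of_surjective (QuotientGroup.mk' N) (QuotientGroup.mk'_surjective N)

theorem card_quotient_lt {G : Type*} [Group G] [Finite G] {N : Subgroup G} (hN : N ≠ ⊥) :
    Nat.card (G ⧸ N) < Nat.card G := by
  have h1 : 1 < Nat.card N := (Subgroup.one_lt_card_iff_ne_bot N).2 hN
  have h2 : 0 < Nat.card (G ⧸ N) := Nat.card_pos
  rw [Subgroup.card_eq_card_quotient_mul_card_subgroup N]
  nlinarith

theorem IsSupersoluble.isNilpotent_of_le_powCommutator {p : ℕ} [hp : Fact p.Prime] (n : ℕ) :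
    ∀ {G : Type*} [Group G] [Finite G], Nat.card G = n → IsSupersoluble G →
      ∀ {E L : Subgroup G}, E.Normal → IsPGroup p E → E ≤ L → L ≤ powCommutator p G →
      (∀ x ∈ L, ∀ y ∈ L, ⁅x, y⁆ ∈ E) → Group.IsNilpotent L := by
  induction n using Nat.strong_induction_on with
  | _ n ih =>
  intro G _ _ hn hG E L hE hpE hEL hLD hab
  by_cases hbot : E = ⊥
  · subst hbot
    let _ : CommGroup L :=
      { (inferInstance : Group L) with
        mul_comm := fun x y => Subtype.ext
          (commutatorElement_eq_one_iff_mul_comm.1 (Subgroup.mem_bot.1 (hab x x.2 y y.2))) }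
    exact CommGroup.isNilpotent
  · obtain ⟨A, hAE, hA⟩ := exists_isMinimalNormal_le hE hbot
    have hAn := hA.1
    have hcyc : IsCyclic A :=
      hG.isCyclic_of_isMinimalNormal (MonoidHom.id G) hA (by simp [MonoidHom.ker_id])
    have hprime := hA.prime_card
    have hcard : Nat.card A = p := by
      obtain ⟨k, hk⟩ := IsPGroup.iff_card.1 (hpE.to_le hAE)
      have hdvd : Nat.card A ∣ p := hprime.dvd_of_dvd_pow hk.dvd
      exact (Nat.prime_dvd_prime_iff_eq hprime hp.out).1 hdvd
    let π := QuotientGroup.mk' A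
    have hnil : Group.IsNilpotent (L.map π) := by
      refine ih (Nat.card (G ⧸ A)) (hn ▸ card_quotient_lt hA.2.1) rfl (hG.quotient A)
        (hE.map π (QuotientGroup.mk'_surjective A)) (hpE.map π) (Subgroup.map_mono hEL)
        (Subgroup.map_le_iff_le_comap.2 (hLD.trans (powCommutator_le_comap p π))) ?_
      rintro _ ⟨x, hx, rfl⟩ _ ⟨y, hy, rfl⟩
      exact ⟨⁅x, y⁆, hab x hx y hy, map_commutatorElement _ _ _⟩
    refine Subgroup.isNilpotent_of_ker_le_center (π.subgroupMap L) fun x hx => ?_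
    have hxA : (x : G) ∈ A := (QuotientGroup.eq_one_iff (x : G)).1 (congrArg Subtype.val hx)
    rw [Subgroup.mem_center_iff]
    intro y
    exact Subtype.ext
      (Subgroup.mem_centralizer_iff.1 (powCommutator_le_centralizer hAn hcard (hLD y.2)) x hxA).symm

theorem IsSupersoluble.isPGroup_powCommutator {p : ℕ} [hp : Fact p.Prime] {G : Type*} [Group G]
    [Finite G] (hG : IsSupersoluble G)
    (hq : ∀ q : ℕ, q.Prime → q ≠ p → ∀ R : Subgroup G, R.Normal → IsPGroup q R → R = ⊥) :
    IsPGroup p (powCommutator p G) := by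
  obtain ⟨E, -, hE⟩ := (Set.toFinite {K : Subgroup G | K.Normal ∧ IsPGroup p K ∧
    K ≤ powCommutator p G}).exists_le_maximal (a := ⊥) ⟨inferInstance, IsPGroup.of_bot, bot_le⟩
  obtain ⟨hEn, hpE, hED⟩ := hE.prop
  let π := QuotientGroup.mk' E
  have hkerπ : π.ker = E := QuotientGroup.ker_mk' E
  have hkp : IsPGroup p π.ker := hkerπ.symm ▸ hpE
  by_cases hbot : (powCommutator p G).map π = ⊥
  · rw [Subgroup.map_eq_bot_iff, hkerπ] at hbot
    exact hpE.to_le hbot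
  exfalso
  obtain ⟨B, hBD, hB⟩ := exists_isMinimalNormal_le
    ((powCommutator_normal p G).map π (QuotientGroup.mk'_surjective E)) hbot
  have hBn := hB.1
  have hcyc : IsCyclic B :=
    (hG.quotient E).isCyclic_of_isMinimalNormal (MonoidHom.id _) hB (by simp [MonoidHom.ker_id])
  have hprime := hB.prime_card
  have hEL : E ≤ B.comap π := hkerπ.ge.trans (Subgroup.ker_le_comap π B)
  have hLD : B.comap π ≤ powCommutator p G := by
    refine (Subgroup.comap_mono hBD).trans ?_
    rw [Subgroup.comap_map_eq, hkerπ, sup_eq_left.2 hED]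
  have hmapL : (B.comap π).map π = B :=
    Subgroup.map_comap_eq_self_of_surjective (QuotientGroup.mk'_surjective E) B
  by_cases hqp : Nat.card B = p
  · have hpB : IsPGroup p B := IsPGroup.of_card (n := 1) (by rw [hqp, pow_one])
    have hLE : B.comap π ≤ E :=
      hE.le_of_ge ⟨inferInstance, hpB.comap_of_ker_isPGroup π hkp, hLD⟩ hEL
    apply hB.2.1
    rw [← hmapL, Subgroup.map_eq_bot_iff, hkerπ]
    exact hLE
  · have : Fact (Nat.card B).Prime := ⟨hprime⟩
    have hnil : Group.IsNilpotent (B.comap π) := by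
      refine IsSupersoluble.isNilpotent_of_le_powCommutator _ rfl hG hEn hpE hEL hLD ?_
      intro x hx y hy
      let _ : CommGroup B := IsCyclic.commGroup
      rw [← hkerπ]
      change π ⁅x, y⁆ = 1
      rw [map_commutatorElement, commutatorElement_eq_one_iff_mul_comm]
      exact congrArg Subtype.val (mul_comm (⟨π x, hx⟩ : B) ⟨π y, hy⟩)
    obtain ⟨Q⟩ := (inferInstance : Nonempty (Sylow (Nat.card B) (B.comap π)))
    have htfae := (Group.isNilpotent_of_finite_tfae (G := B.comap π)).out 0 3
    have hQn : (Q : Subgroup (B.comap π)).Normal := htfae.1 hnil _ inferInstance Q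
    have hQc := Q.characteristic_of_normal hQn
    have hQbot := hq _ hprime hqp ((Q : Subgroup (B.comap π)).map (B.comap π).subtype)
      ConjAct.normal_of_characteristic_of_normal (Q.isPGroup'.map _)
    rw [Subgroup.map_eq_bot_iff_of_injective _ (Subgroup.subtype_injective _)] at hQbot
    refine Q.ne_bot_of_dvd_card ?_ hQbot
    have h := Subgroup.card_map_dvd (H := B.comap π) π
    rwa [hmapL] at h

theorem exists_ne_one_map_eq_pow {p : ℕ} [hp : Fact p.Prime] {A : Type*} [CommGroup A] [Finite A]
    [Nontrivial A] (hA : ∀ x : A, x ^ p = 1) (φ : A →* A) (hφ : ∀ x, φ^[p] x = φ x) :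
    ∃ x ≠ 1, ∃ k : ℕ, φ x = x ^ k := by
  let _ : Module (ZMod p) (Additive A) := AddCommGroup.zmodModule (n := p) fun x => hA x.toMul
  let f : Module.End (ZMod p) (Additive A) := AddMonoidHom.toZModLinearMap p φ.toAdditive
  have hf : f ^ p = f := by
    ext x
    rw [Module.End.pow_apply]
    exact hφ x.toMul
  have hdvd : minpoly (ZMod p) f ∣ Polynomial.X ^ p - Polynomial.X := by
    apply minpoly.dvd
    simp [hf]
  have hsplit : (Polynomial.X ^ p - Polynomial.X : Polynomial (ZMod p)).Splits := by
    simpa using FiniteField.splits_X_pow_card_sub_X p (K := ZMod p)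
  have hint : IsIntegral (ZMod p) f := Algebra.IsIntegral.isIntegral f
  have hms := hsplit.of_dvd (FiniteField.X_pow_card_sub_X_ne_zero (ZMod p) hp.out.one_lt) hdvd
  obtain ⟨μ, hμ⟩ := hms.exists_eval_eq_zero (minpoly.degree_pos hint).ne'
  obtain ⟨v, hv⟩ := (Module.End.hasEigenvalue_of_isRoot hμ).exists_hasEigenvector
  refine ⟨v.toMul, hv.2, μ.val, ?_⟩
  have h1 : f v = μ • v := hv.apply_eq_smul
  have h2 : μ • v = μ.val • v := by
    conv_lhs => rw [← ZMod.natCast_zmod_val μ]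
    exact Nat.cast_smul_eq_nsmul (ZMod p) μ.val v
  exact h1.trans h2

theorem IsMinimalNormal.eq_bot_or_eq_top_of_characteristic {G : Type*} [Group G] {N : Subgroup G}
    (hN : IsMinimalNormal N) (K : Subgroup N) (hK : K.Characteristic) : K = ⊥ ∨ K = ⊤ := by
  have := hN.1
  by_cases h : K.map N.subtype = ⊥
  · exact Or.inl ((Subgroup.map_eq_bot_iff_of_injective K N.subtype_injective).1 h)
  · right
    have h' := hN.2.2 _ ConjAct.normal_of_characteristic_of_normal h (Subgroup.map_subtype_le K)
    refine Subgroup.map_injective N.subtype_injective (h'.trans ?_)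
    rw [← MonoidHom.range_eq_map, Subgroup.range_subtype]

theorem IsMinimalNormal.isPGroup_of_isNilpotent {G : Type*} [Group G] [Finite G] {N : Subgroup G}
    (hN : IsMinimalNormal N) (hnil : Group.IsNilpotent N) :
    ∃ p : ℕ, p.Prime ∧ IsPGroup p N := by
  have hcard : Nat.card N ≠ 1 := fun h => hN.2.1 (Subgroup.card_eq_one.1 h)
  obtain ⟨p, hp, hpN⟩ := Nat.exists_prime_and_dvd hcard
  have : Fact p.Prime := ⟨hp⟩
  obtain ⟨P⟩ := (inferInstance : Nonempty (Sylow p N))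
  have htfae := (Group.isNilpotent_of_finite_tfae (G := N)).out 0 3
  have hPn : (P : Subgroup N).Normal := htfae.1 hnil _ inferInstance P
  have htop := (hN.eq_bot_or_eq_top_of_characteristic P
    (P.characteristic_of_normal hPn)).resolve_left (P.ne_bot_of_dvd_card hpN)
  exact ⟨p, hp, fun x => by
    obtain ⟨k, hk⟩ := P.isPGroup' ⟨x, htop.ge (Subgroup.mem_top x)⟩
    exact ⟨k, congrArg Subtype.val hk⟩⟩

theorem IsMinimalNormal.mul_comm_of_isPGroup {G : Type*} [Group G] [Finite G] {N : Subgroup G}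
    {p : ℕ} [Fact p.Prime] (hN : IsMinimalNormal N) (hpN : IsPGroup p N) (x y : N) :
    x * y = y * x := by
  have : Nontrivial N := (Subgroup.nontrivial_iff_ne_bot N).2 hN.2.1
  have hc : Subgroup.center N ≠ ⊥ :=
    (Subgroup.nontrivial_iff_ne_bot _).1 hpN.center_nontrivial
  have htop := (hN.eq_bot_or_eq_top_of_characteristic _ inferInstance).resolve_left hc
  exact Subgroup.mem_center_iff.1 (htop.ge (Subgroup.mem_top y)) x

theorem IsMinimalNormal.pow_eq_one_of_isPGroup {G : Type*} [Group G] [Finite G] {N : Subgroup G}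
    {p : ℕ} [hp : Fact p.Prime] (hN : IsMinimalNormal N) (hpN : IsPGroup p N) (x : N) :
    x ^ p = 1 := by
  let _ : CommGroup N :=
    { (inferInstance : Group N) with mul_comm := hN.mul_comm_of_isPGroup hpN }
  have : Nontrivial N := (Subgroup.nontrivial_iff_ne_bot N).2 hN.2.1
  have hchar : (powMonoidHom p : N →* N).ker.Characteristic := by
    refine ⟨fun φ => ?_⟩
    ext y
    simp only [Subgroup.mem_comap, MonoidHom.mem_ker, powMonoidHom_apply, MulEquiv.coe_toMonoidHom,
      ← map_pow]
    exact map_eq_one_iff φ φ.injective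
  have hne : (powMonoidHom p : N →* N).ker ≠ ⊥ := by
    obtain ⟨n, hn0, hn⟩ := (IsPGroup.nontrivial_iff_card hpN).1 inferInstance
    obtain ⟨y, hy⟩ := exists_prime_orderOf_dvd_card' (G := N) p (hn ▸ dvd_pow_self p hn0.ne')
    intro hbot
    have hmem : y ∈ (powMonoidHom p : N →* N).ker := by
      rw [MonoidHom.mem_ker, powMonoidHom_apply, ← hy, pow_orderOf_eq_one]
    rw [hbot, Subgroup.mem_bot] at hmem
    rw [hmem, orderOf_one] at hy
    exact hp.out.ne_one hy.symm
  have htop := (hN.eq_bot_or_eq_top_of_characteristic _ hchar).resolve_left hne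
  exact htop.ge (Subgroup.mem_top x)

theorem IsMinimalNormal.isCyclic_of_powCommutator_le_centralizer {G : Type*} [Group G] [Finite G]
    {N : Subgroup G} {p : ℕ} [hp : Fact p.Prime] (hN : IsMinimalNormal N) (hpN : IsPGroup p N)
    (hD : powCommutator p G ≤ Subgroup.centralizer N) : IsCyclic N := by
  have hNn := hN.1
  let _ : CommGroup N :=
    { (inferInstance : Group N) with mul_comm := hN.mul_comm_of_isPGroup hpN }
  have : Nontrivial N := (Subgroup.nontrivial_iff_ne_bot N).2 hN.2.1
  have hDN : ∀ d ∈ powCommutator p G, ∀ x ∈ N, d * x * d⁻¹ = x := fun d hd x hx =>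
    mul_inv_eq_iff_eq_mul.2 (Subgroup.mem_centralizer_iff.1 (hD hd) x hx).symm
  have hscalar : ∀ g : G, ∃ k : ℕ, ∀ x ∈ N, g * x * g⁻¹ = x ^ k := by
    intro g
    let φ : N →* N := (MulAut.conjNormal (H := N) g).toMonoidHom
    have hiter : ∀ (n : ℕ) (x : N), ((φ^[n] x : N) : G) = g ^ n * x * (g ^ n)⁻¹ := by
      intro n
      induction n with
      | zero => simp
      | succ n ih =>
        intro x
        rw [Function.iterate_succ_apply', pow_succ']
        change g * (φ^[n] x : N) * g⁻¹ = _
        rw [ih]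
        group
    obtain ⟨v, hv1, k, hk⟩ := exists_ne_one_map_eq_pow (hN.pow_eq_one_of_isPGroup hpN) φ (by
      intro x
      refine Subtype.ext ?_
      rw [hiter]
      change _ = g * (x : G) * g⁻¹
      have h1 : g ^ p = g * g ^ (p - 1) := by
        rw [← pow_succ', Nat.sub_add_cancel hp.out.one_le]
      have h2 := hDN _ (pow_mem_powCommutator p g) x x.2
      calc g ^ p * (x : G) * (g ^ p)⁻¹ = g * (g ^ (p - 1) * x * (g ^ (p - 1))⁻¹) * g⁻¹ := by
            rw [h1]; group
        _ = _ := by rw [h2])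
    let W : Subgroup G :=
      { carrier := {x | x ∈ N ∧ g * x * g⁻¹ = x ^ k}
        one_mem' := ⟨N.one_mem, by simp⟩
        mul_mem' := by
          rintro a b ⟨ha, ha'⟩ ⟨hb, hb'⟩
          refine ⟨N.mul_mem ha hb, ?_⟩
          have hcomm : Commute a b := congrArg Subtype.val (mul_comm (⟨a, ha⟩ : N) ⟨b, hb⟩)
          rw [hcomm.mul_pow, ← ha', ← hb']
          group
        inv_mem' := by
          rintro a ⟨ha, ha'⟩
          refine ⟨N.inv_mem ha, ?_⟩
          rw [inv_pow, ← ha']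
          group }
    have hWn : W.Normal := by
      refine ⟨fun x hx t => ⟨hNn.conj_mem x hx.1 t, ?_⟩⟩
      have h1 := hDN _ (commutator_mem_powCommutator p t⁻¹ g) _ (hNn.conj_mem x hx.1 g)
      rw [commutatorElement_def] at h1
      calc g * (t * x * t⁻¹) * g⁻¹
          = t * (t⁻¹ * g * t⁻¹⁻¹ * g⁻¹ * (g * x * g⁻¹) * (t⁻¹ * g * t⁻¹⁻¹ * g⁻¹)⁻¹) * t⁻¹ := by group
        _ = t * x ^ k * t⁻¹ := by rw [h1, hx.2]
        _ = (t * x * t⁻¹) ^ k := (conj_pow (a := t) (b := x)).symm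
    have hvW : (v : G) ∈ N ⊓ W := ⟨v.2, v.2, congrArg Subtype.val hk⟩
    have hNW : N ≤ W := hN.le_of_inf_ne_bot hWn fun h =>
      hv1 (Subtype.ext (Subgroup.mem_bot.1 (h ▸ hvW)))
    exact ⟨k, fun x hx => (hNW hx).2⟩
  obtain ⟨v, hv⟩ := exists_ne (1 : N)
  have hzn : (Subgroup.zpowers (v : G)).Normal := by
    refine ⟨fun x hx g => ?_⟩
    obtain ⟨k, hk⟩ := hscalar g
    rw [hk x (Subgroup.zpowers_le.2 v.2 hx)]
    exact pow_mem hx k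
  have hz := hN.2.2 _ hzn (fun h => hv (Subtype.ext (Subgroup.zpowers_eq_bot.1 h)))
    (by rw [Subgroup.zpowers_le]; exact v.2)
  rw [← hz]
  infer_instance

theorem IsPGroup.inf_centralizer_ne_bot {p : ℕ} [hp : Fact p.Prime] {G : Type*} [Group G]
    [Finite G] {D N : Subgroup G} (hD : IsPGroup p D) (hN : N.Normal) (hpN : IsPGroup p N)
    (hbot : N ≠ ⊥) : N ⊓ Subgroup.centralizer D ≠ ⊥ := by
  let _ : MulAction D N := MulAction.compHom N ((MulAut.conjNormal (H := N)).comp D.subtype)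
  have : Nontrivial N := (Subgroup.nontrivial_iff_ne_bot N).2 hbot
  obtain ⟨n, hn0, hn⟩ := (IsPGroup.nontrivial_iff_card hpN).1 inferInstance
  have hsmul : ∀ (d : D) (x : N), ((d • x : N) : G) = d * x * (d : G)⁻¹ := fun d x => rfl
  obtain ⟨b, hb, hb1⟩ := hD.exists_fixed_point_of_prime_dvd_card_of_fixed_point N
    (hn ▸ dvd_pow_self p hn0.ne') (a := 1) (fun d => Subtype.ext (by simp [hsmul]))
  intro h
  have hmem : (b : G) ∈ N ⊓ Subgroup.centralizer D := by
    refine ⟨b.2, Subgroup.mem_centralizer_iff.2 fun d hd => ?_⟩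
    exact mul_inv_eq_iff_eq_mul.1 (congrArg Subtype.val (hb ⟨d, hd⟩))
  rw [h, Subgroup.mem_bot] at hmem
  exact hb1 (Subtype.ext hmem.symm)

theorem eq_bot_of_isPGroup_quotient_of_le_frattini {G : Type*} [Group G] [Finite G]
    {N : Subgroup G} {p q : ℕ} [Fact p.Prime] [Fact q.Prime] (hqp : q ≠ p) [N.Normal]
    (hbot : N ≠ ⊥) (hpN : IsPGroup p N) (hΦ : N ≤ frattini G)
    (hmono : ∀ R : Subgroup G, R.Normal → R ≠ ⊥ → N ≤ R)
    {B : Subgroup (G ⧸ N)} (hB : B.Normal) (hqB : IsPGroup q B) : B = ⊥ := by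
  let π := QuotientGroup.mk' N
  have hkerπ : π.ker = N := QuotientGroup.ker_mk' N
  obtain ⟨Q⟩ := (inferInstance : Nonempty (Sylow q (B.comap π)))
  let Q' : Subgroup G := (Q : Subgroup (B.comap π)).map (B.comap π).subtype
  have hQ'p : IsPGroup q Q' := Q.isPGroup'.map _
  have hQ'B : Q'.map π = B := by
    have hsurj : Function.Surjective (π.subgroupComap B) :=
      MonoidHom.subgroupComap_surjective_of_surjective π B (QuotientGroup.mk'_surjective N)
    have htop : ((Q.mapSurjective hsurj : Sylow q B) : Subgroup B) = ⊤ := by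
      refine ((Q.mapSurjective hsurj).is_maximal' (Q := ⊤) ?_ le_top).symm
      exact hqB.to_subgroup ⊤
    rw [Sylow.coe_mapSurjective] at htop
    have h1 : ((Q : Subgroup (B.comap π)).map (π.subgroupComap B)).map B.subtype = B := by
      rw [htop, ← MonoidHom.range_eq_map, Subgroup.range_subtype]
    rw [Subgroup.map_map] at h1
    change ((Q : Subgroup (B.comap π)).map (B.comap π).subtype).map π = B
    rw [Subgroup.map_map]
    exact h1
  have hQ'N : B.comap π = Q' ⊔ N := by
    rw [← hQ'B, Subgroup.comap_map_eq, hkerπ]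
  have hnorm : Subgroup.normalizer (Q' : Set G) ⊔ N = ⊤ := by
    have h : Subgroup.normalizer (Q' : Set G) ⊔ B.comap π = ⊤ := Q.normalizer_sup_eq_top
    rw [hQ'N, ← sup_assoc, sup_eq_left.2 (Subgroup.le_normalizer (H := Q'))] at h
    exact h
  have hQ'n : Q'.Normal := by
    rw [← Subgroup.normalizer_eq_top_iff]
    exact frattini_nongenerating (top_le_iff.1 (hnorm.ge.trans (sup_le_sup_left hΦ _)))
  have hQ'bot : Q' = ⊥ := by
    by_contra hne
    have hdisj := IsPGroup.disjoint_of_ne p q hqp.symm N Q' hpN hQ'p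
    exact hbot (disjoint_self.1 (hdisj.mono_right (hmono Q' hQ'n hne)))
  rw [← hQ'B, hQ'bot, Subgroup.map_bot]

theorem exists_isCoatom_not_le_of_not_le_frattini {G : Type*} [Group G] {N : Subgroup G}
    (h : ¬ N ≤ frattini G) : ∃ M : Subgroup G, IsCoatom M ∧ ¬ N ≤ M := by
  by_contra! hcon
  exact h (le_iInf₂ fun M hM => hcon M hM)

theorem normalCore_comap_le {G G' : Type*} [Group G] [Group G'] (f : G →* G')
    (hf : Function.Surjective f) (M : Subgroup G') :
    (M.comap f).normalCore ≤ M.normalCore.comap f := by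
  have := (Subgroup.normalCore_normal (M.comap f)).map f hf
  rw [← Subgroup.map_le_iff_le_comap, Subgroup.normal_le_normalCore, Subgroup.map_le_iff_le_comap]
  exact Subgroup.normalCore_le _

/-- A group is supersoluble if all its primitive quotients are. -/
theorem isSupersoluble_of_quotient_normalCore (n : ℕ) :
    ∀ {G : Type*} [Group G] [Finite G], Nat.card G = n →
      (∀ M : Subgroup G, IsCoatom M → IsSupersoluble (G ⧸ M.normalCore)) → IsSupersoluble G := by
  induction n using Nat.strong_induction_on with
  | _ n ih =>
  intro G _ _ hn h
  cases subsingleton_or_nontrivial G with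
  | inl hsub =>
    exact ⟨0, fun _ => ⊥, fun _ => inferInstance, rfl, Subsingleton.elim _ _, fun i => i.elim0⟩
  | inr hnt =>
  have hquot : ∀ (R : Subgroup G) [R.Normal], R ≠ ⊥ → IsSupersoluble (G ⧸ R) := by
    intro R _ hR
    refine ih _ (hn ▸ card_quotient_lt hR) rfl fun M hM => ?_
    have hs := QuotientGroup.mk'_surjective R
    refine (h _ (Subgroup.isCoatom_comap_of_surjective hs hM)).of_surjective
      (QuotientGroup.map _ _ (QuotientGroup.mk' R) (normalCore_comap_le _ hs M)) ?_
    exact QuotientGroup.map_surjective_of_surjective _ _ _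
      ((QuotientGroup.mk'_surjective _).comp hs) _
  obtain ⟨N, -, hN⟩ := exists_isMinimalNormal_le (G := G) (H := ⊤) inferInstance top_ne_bot
  have hNn := hN.1
  suffices hcyc : IsCyclic N by
    refine (hquot N hN.2.1).of_isCyclic_ker (QuotientGroup.mk' N) ?_
    rwa [QuotientGroup.ker_mk']
  by_cases hΦ : N ≤ frattini G
  swap
  · obtain ⟨M, hM, hNM⟩ := exists_isCoatom_not_le_of_not_le_frattini hΦ
    refine (h M hM).isCyclic_of_isMinimalNormal (QuotientGroup.mk' M.normalCore) hN ?_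
    rw [QuotientGroup.ker_mk']
    by_contra hne
    exact hNM ((hN.le_of_inf_ne_bot inferInstance hne).trans (Subgroup.normalCore_le M))
  by_cases hmono : ∀ R : Subgroup G, R.Normal → R ≠ ⊥ → N ≤ R
  swap
  · push Not at hmono
    obtain ⟨R, hR, hRbot, hNR⟩ := hmono
    refine (hquot R hRbot).isCyclic_of_isMinimalNormal (QuotientGroup.mk' R) hN ?_
    rw [QuotientGroup.ker_mk']
    by_contra hne
    exact hNR (hN.le_of_inf_ne_bot hR hne)
  have hfn : Group.IsNilpotent (frattini G) := frattini_nilpotent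
  have hnil : Group.IsNilpotent N :=
    Subgroup.isNilpotent_of_ker_le_center (Subgroup.inclusion hΦ)
      (((MonoidHom.ker_eq_bot_iff _).2 (Subgroup.inclusion_injective hΦ)).trans_le bot_le)
  obtain ⟨p, hp, hpN⟩ := hN.isPGroup_of_isNilpotent hnil
  have : Fact p.Prime := ⟨hp⟩
  have hDquot : IsPGroup p (powCommutator p (G ⧸ N)) := by
    refine (hquot N hN.2.1).isPGroup_powCommutator fun q hq hqp B hB hqB => ?_
    have : Fact q.Prime := ⟨hq⟩
    exact eq_bot_of_isPGroup_quotient_of_le_frattini hqp hN.2.1 hpN hΦ hmono hB hqB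
  have hD : IsPGroup p (powCommutator p G) :=
    (hDquot.comap_of_ker_isPGroup (QuotientGroup.mk' N)
      ((QuotientGroup.ker_mk' N).symm ▸ hpN)).to_le (powCommutator_le_comap p _)
  refine hN.isCyclic_of_powCommutator_le_centralizer hpN ?_
  rw [Subgroup.le_centralizer_iff]
  exact hN.le_of_inf_ne_bot inferInstance (hD.inf_centralizer_ne_bot hNn hpN hN.2.1)

theorem isCoatom_map_of_surjective {G G' : Type*} [Group G] [Group G'] {f : G →* G'}
    (hf : Function.Surjective f) {M : Subgroup G} (hM : IsCoatom M)
    (hcomap : (M.map f).comap f = M) : IsCoatom (M.map f) := by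
  refine ⟨fun htop => hM.1 (by rw [← hcomap, htop, Subgroup.comap_top]), fun L hL => ?_⟩
  have h := hM.2 (L.comap f) (by
    rw [← hcomap]
    exact (Subgroup.comap_lt_comap_of_surjective hf).2 hL)
  rw [← Subgroup.map_comap_eq_self_of_surjective hf L, h, Subgroup.map_top_of_surjective f hf]

theorem isNonFrattini_iff {G : Type*} [Group G] {H K : Subgroup G} (hK : K.Normal) :
    IsNonFrattini H K hK ↔ ∃ M : Subgroup G, IsCoatom M ∧ K ≤ M ∧ ¬ H ≤ M := by
  have hs := QuotientGroup.mk'_surjective K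
  have hker := QuotientGroup.ker_mk' K
  constructor
  · intro h
    obtain ⟨M, hM, hHM⟩ := exists_isCoatom_not_le_of_not_le_frattini h
    refine ⟨M.comap (QuotientGroup.mk' K), Subgroup.isCoatom_comap_of_surjective hs hM,
      hker.ge.trans (Subgroup.ker_le_comap _ M), ?_⟩
    rwa [← Subgroup.map_le_iff_le_comap]
  · rintro ⟨M, hM, hKM, hHM⟩ hle
    have hcomap : (M.map (QuotientGroup.mk' K)).comap (QuotientGroup.mk' K) = M := by
      rw [Subgroup.comap_map_eq, hker, sup_eq_left.2 hKM]
    have h := hle.trans (frattini_le_coatom (isCoatom_map_of_surjective hs hM hcomap))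
    rw [Subgroup.map_le_iff_le_comap, hcomap] at h
    exact hHM h

theorem mem_chiefCentralizer_iff {G : Type*} [Group G] {H K : Subgroup G} (hK : K.Normal) {g : G} :
    g ∈ chiefCentralizer H K hK ↔ ∀ x ∈ H, ⁅x, g⁆ ∈ K := by
  have hiff : ∀ x : G, ⁅x, g⁆ ∈ K ↔ (x : G ⧸ K) * g = g * x := by
    intro x
    rw [← commutatorElement_eq_one_iff_mul_comm, ← QuotientGroup.eq_one_iff]
    exact Iff.rfl
  simp only [hiff, chiefCentralizer, Subgroup.mem_comap, Subgroup.mem_centralizer_iff]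
  constructor
  · exact fun h x hx => h _ ⟨x, hx, rfl⟩
  · rintro h _ ⟨x, hx, rfl⟩
    exact h x hx

/-- A chief factor avoided by a normal subgroup `C` of `G` containing its bottom maps to a minimal
normal subgroup of `G ⧸ C`. -/
theorem IsChiefFactor.map_mk' {G : Type*} [Group G] {H K C : Subgroup G} [C.Normal]
    (hc : IsChiefFactor H K) (hKC : K ≤ C) (hHC : ¬ H ≤ C) :
    IsChiefFactor (H.map (QuotientGroup.mk' C)) ⊥ := by
  have hs := QuotientGroup.mk'_surjective C
  have hker := QuotientGroup.ker_mk' C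
  obtain ⟨hK, hH, hlt, hmin⟩ := hc
  refine ⟨inferInstance, hH.map _ hs, ?_, fun L hL hbot hle => ?_⟩
  · rw [bot_lt_iff_ne_bot, Ne, Subgroup.map_eq_bot_iff, hker]
    exact hHC
  · refine le_antisymm hle ?_
    rw [Subgroup.map_le_iff_le_comap]
    have hK1 : K ≤ L.comap (QuotientGroup.mk' C) ⊓ H :=
      le_inf (hKC.trans (hker.ge.trans (Subgroup.ker_le_comap _ L))) hlt.le
    rcases hK1.eq_or_lt with heq | hlt'
    · exfalso
      refine hbot.not_ge ?_
      intro y hy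
      obtain ⟨x, hx, rfl⟩ := hle hy
      have hxK : x ∈ K := heq.ge ⟨hy, hx⟩
      exact (QuotientGroup.eq_one_iff x).2 (hKC hxK)
    · exact inf_eq_right.1 (hmin _ inferInstance hlt' inf_le_right)

theorem IsChiefFactor.index_chiefCentralizer_map_mk' {G : Type*} [Group G] {H K C : Subgroup G}
    [C.Normal] (hc : IsChiefFactor H K) (hKC : K ≤ C) (hHC : ¬ H ≤ C) :
    (chiefCentralizer (H.map (QuotientGroup.mk' C)) ⊥ inferInstance).index =
      (chiefCentralizer H K hc.1).index := by
  obtain ⟨hK, hH, hlt, hmin⟩ := hc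
  have hinf : ∀ x ∈ H, x ∈ C → x ∈ K := by
    intro x hx hxC
    rcases (le_inf hlt.le hKC).eq_or_lt with heq | hlt'
    · exact heq.ge ⟨hx, hxC⟩
    · exact absurd (inf_eq_left.1 (hmin _ inferInstance hlt' inf_le_left)) hHC
  rw [← Subgroup.index_comap_of_surjective _ (QuotientGroup.mk'_surjective C)]
  congr 1
  ext g
  rw [Subgroup.mem_comap, mem_chiefCentralizer_iff, mem_chiefCentralizer_iff]
  have hiff : ∀ x ∈ H, (⁅QuotientGroup.mk' C x, QuotientGroup.mk' C g⁆ ∈ (⊥ : Subgroup (G ⧸ C)) ↔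
      ⁅x, g⁆ ∈ K) := by
    intro x hx
    rw [← map_commutatorElement, Subgroup.mem_bot]
    refine (QuotientGroup.eq_one_iff _).trans ⟨hinf _ ?_, fun h => hKC h⟩
    rw [commutatorElement_def, mul_assoc, mul_assoc, ← mul_assoc g]
    exact H.mul_mem hx (hH.conj_mem _ (H.inv_mem hx) g)
  constructor
  · exact fun h x hx => (hiff x hx).1 (h _ ⟨x, hx, rfl⟩)
  · rintro h _ ⟨x, hx, rfl⟩
    exact (hiff x hx).2 (h x hx)

/-- The class of nearly nilpotent groups is a Schunck class: if `G/M_G` is nearly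
nilpotent for every maximal subgroup `M` of `G`, then `G` is nearly nilpotent. -/
theorem nearlyNilpotent_of_quotient_normalCore
    {G : Type*} [Group G] [Finite G]
    (h : ∀ M : Subgroup G, IsMaximalIn ⊤ M → IsNearlyNilpotent (G ⧸ M.normalCore)) :
    IsNearlyNilpotent G := by
  have hmax : ∀ M : Subgroup G, IsCoatom M → IsNearlyNilpotent (G ⧸ M.normalCore) :=
    fun M hM => h M ⟨hM.lt_top, fun L hL _ => hM.2 L hL⟩
  refine ⟨isSupersoluble_of_quotient_normalCore _ rfl fun M hM => (hmax M hM).1,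
    fun H K hc hnF => ?_⟩
  have hK := hc.1
  obtain ⟨M, hM, hKM, hHM⟩ := (isNonFrattini_iff hc.1).1 hnF
  have hKC : K ≤ M.normalCore := Subgroup.normal_le_normalCore.2 hKM
  have hHC : ¬ H ≤ M.normalCore := fun hle => hHM (hle.trans (Subgroup.normalCore_le M))
  rw [← hc.index_chiefCentralizer_map_mk' hKC hHC]
  refine (hmax M hM).2 _ _ (hc.map_mk' hKC hHC) ((isNonFrattini_iff _).2 ?_)
  have hcomap : (M.map (QuotientGroup.mk' M.normalCore)).comap
      (QuotientGroup.mk' M.normalCore) = M := by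
    rw [Subgroup.comap_map_eq, QuotientGroup.ker_mk', sup_eq_left.2 (Subgroup.normalCore_le M)]
  refine ⟨M.map (QuotientGroup.mk' M.normalCore),
    isCoatom_map_of_surjective (QuotientGroup.mk'_surjective _) hM hcomap, bot_le, ?_⟩
  rwa [Subgroup.map_le_iff_le_comap, hcomap]
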